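/- arXiv:1004.0458 — 2 statements merged into one kernel-verified Lean document; each statement's English description precedes it below -/
import Mathlib

section
/- Let v_ED = (0,-1,1), v_SD = (2,-1,-1), v_TP = (-2,1,-1) in ℝ³ (the rate triples of entanglement distribution, super-dense coding, and teleportation). Then for every (C,Q,E) ∈ ℝ³, there exist real numbers α, β, γ ≥ 0 with (C,Q,E) = α·v_ED + β·v_SD + γ·v_TP if and only if C + 2Q ≤ 0, Q + E ≤ 0, and C + Q + E ≤ 0. That is, the unit resource achievable region (the cone generated by the three unit protocols) coincides with the polyhedron cut out by these three inequalities. -/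
/-- The unit resource rate triples: entanglement distribution, super-dense
coding, and teleportation, as points of `ℝ × ℝ × ℝ` (coordinates `(C, Q, E)`). -/
def vED : ℝ × ℝ × ℝ := (0, -1, 1)
def vSD : ℝ × ℝ × ℝ := (2, -1, -1)
def vTP : ℝ × ℝ × ℝ := (-2, 1, -1)

/-- The unit resource achievable region, i.e. the cone generated by
entanglement distribution, super-dense coding and teleportation, coincides with
the polyhedron `{(C,Q,E) : C + 2Q ≤ 0, Q + E ≤ 0, C + Q + E ≤ 0}`. -/
theorem unit_resource_region_eq_polyhedron (C Q E : ℝ) :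
    (∃ α β γ : ℝ, 0 ≤ α ∧ 0 ≤ β ∧ 0 ≤ γ ∧
      (C, Q, E) = α • vED + β • vSD + γ • vTP) ↔
    (C + 2 * Q ≤ 0 ∧ Q + E ≤ 0 ∧ C + Q + E ≤ 0) := by
  simp only [vED, vSD, vTP, Prod.smul_mk, Prod.mk_add_mk, Prod.mk.injEq, smul_eq_mul]
  constructor
  · rintro ⟨α, β, γ, hα, hβ, hγ, hC, hQ, hE⟩
    refine ⟨?_, ?_, ?_⟩ <;> linarith
  · rintro ⟨hα, hβ, hγ⟩
    refine ⟨-(C + 2 * Q) / 2, -(Q + E) / 2, -(C + Q + E) / 2, ?_, ?_, ?_, ?_, ?_, ?_⟩ <;> linarith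
end

section
/- Fix ε ∈ [0,1] and let N_ε be the qubit erasure channel. The Holevo information of N_ε equals 1 − ε: the supremum, over all finite ensembles {p(x), ρ_x} of 2×2 density matrices, of H(N_ε(∑_x p(x) ρ_x)) − ∑_x p(x) H(N_ε(ρ_x)) is exactly 1 − ε (and it is attained, e.g., by the uniform ensemble on the two computational basis states). -/
open scoped BigOperators ComplexOrder

/-- Von Neumann entropy in bits: `H(ρ) = -∑ λᵢ log₂ λᵢ` over the eigenvalues of a
Hermitian matrix (and `0` by convention on non-Hermitian input). -/
noncomputable def vNEntropy {d : Type} [Fintype d] [DecidableEq d]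
    (ρ : Matrix d d ℂ) : ℝ :=
  if h : ρ.IsHermitian then (∑ i, Real.negMulLog (h.eigenvalues i)) / Real.log 2
  else 0

/-- `ρ` is a density matrix. -/
def IsDensityMatrix {d : Type} [Fintype d] [DecidableEq d]
    (ρ : Matrix d d ℂ) : Prop :=
  ρ.PosSemidef ∧ ρ.trace = 1

/-- The qubit erasure channel with erasure parameter `ε`: the output is the
`3 × 3` matrix with upper-left `2 × 2` block `(1-ε)ρ`, entry `ε` at position
`(3,3)`, and zeros elsewhere. -/
noncomputable def erasureChannel (ε : ℝ) (ρ : Matrix (Fin 2) (Fin 2) ℂ) :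
    Matrix (Fin 3) (Fin 3) ℂ :=
  fun i j =>
    if hi : (i : ℕ) < 2 then
      if hj : (j : ℕ) < 2 then ((1 - ε : ℝ) : ℂ) * ρ ⟨i, hi⟩ ⟨j, hj⟩ else 0
    else if (j : ℕ) < 2 then 0 else ((ε : ℝ) : ℂ)

/-- The set of Holevo quantities `H(N(ρ̄)) - ∑ₓ p(x) H(N(ρₓ))` of the qubit
erasure channel `N_ε`, over all finite ensembles `{p(x), ρₓ}` of qubit density
matrices. -/
noncomputable def erasureHolevoSet (ε : ℝ) : Set ℝ :=
  { h | ∃ (k : ℕ) (p : Fin k → ℝ) (ρ : Fin k → Matrix (Fin 2) (Fin 2) ℂ),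
      (∀ x, 0 ≤ p x) ∧ (∑ x, p x = 1) ∧ (∀ x, IsDensityMatrix (ρ x)) ∧
      h = vNEntropy (erasureChannel ε (∑ x, (p x : ℂ) • ρ x))
        - ∑ x, p x * vNEntropy (erasureChannel ε (ρ x)) }

/-- The entropy of a Hermitian matrix can be read off any factorization of its characteristic
polynomial. -/
theorem vNEntropy_eq_of_charpoly_eq {d : Type} [Fintype d] [DecidableEq d]
    {A : Matrix d d ℂ} (hA : A.IsHermitian) (μ : d → ℝ)
    (h : A.charpoly = ∏ i, (Polynomial.X - Polynomial.C (μ i : ℂ))) :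
    vNEntropy A = (∑ i, Real.negMulLog (μ i)) / Real.log 2 := by
  have hroots := hA.roots_charpoly_eq_eigenvalues
  rw [h, Polynomial.roots_prod _ _ (Finset.prod_ne_zero_iff.2 fun i _ ↦
    Polynomial.X_sub_C_ne_zero _)] at hroots
  simp only [Polynomial.roots_X_sub_C, Multiset.bind_singleton] at hroots
  have hsum := congrArg
    (fun s : Multiset ℂ ↦ (s.map fun z ↦ Real.negMulLog z.re).sum) hroots
  simp only [Multiset.map_map, Function.comp_def, Complex.ofReal_re] at hsum
  rw [vNEntropy, dif_pos hA]
  congr 1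
  simpa using hsum.symm

theorem vNEntropy_diagonal {d : Type} [Fintype d] [DecidableEq d] (μ : d → ℝ) :
    vNEntropy (Matrix.diagonal fun i ↦ (μ i : ℂ)) =
      (∑ i, Real.negMulLog (μ i)) / Real.log 2 :=
  vNEntropy_eq_of_charpoly_eq
    (Matrix.isHermitian_diagonal_of_self_adjoint _ (by ext i; simp)) μ
    (Matrix.charpoly_diagonal _)

theorem IsDensityMatrix.eigenvalues_add {ρ : Matrix (Fin 2) (Fin 2) ℂ}
    (h : IsDensityMatrix ρ) :
    h.1.isHermitian.eigenvalues 0 + h.1.isHermitian.eigenvalues 1 = 1 := by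
  have ht := h.1.isHermitian.trace_eq_sum_eigenvalues
  have hre := congrArg Complex.re (ht.symm.trans h.2)
  simpa [Fin.sum_univ_two] using hre

/-- The entropy of a qubit is the binary entropy of an eigenvalue. -/
theorem IsDensityMatrix.vNEntropy_eq_binEntropy {ρ : Matrix (Fin 2) (Fin 2) ℂ}
    (h : IsDensityMatrix ρ) :
    vNEntropy ρ = Real.binEntropy (h.1.isHermitian.eigenvalues 0) / Real.log 2 := by
  rw [vNEntropy, dif_pos h.1.isHermitian, Fin.sum_univ_two,
    Real.binEntropy_eq_negMulLog_add_negMulLog_one_sub, ← h.eigenvalues_add,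
    add_sub_cancel_left]

theorem IsDensityMatrix.vNEntropy_nonneg {ρ : Matrix (Fin 2) (Fin 2) ℂ}
    (h : IsDensityMatrix ρ) : 0 ≤ vNEntropy ρ := by
  have h0 := h.1.eigenvalues_nonneg 0
  have h1 := h.1.eigenvalues_nonneg 1
  have hadd := h.eigenvalues_add
  rw [h.vNEntropy_eq_binEntropy]
  exact div_nonneg (Real.binEntropy_nonneg h0 (by linarith)) (Real.log_nonneg one_le_two)

theorem IsDensityMatrix.vNEntropy_le_one {ρ : Matrix (Fin 2) (Fin 2) ℂ}
    (h : IsDensityMatrix ρ) : vNEntropy ρ ≤ 1 := by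
  rw [h.vNEntropy_eq_binEntropy, div_le_one (Real.log_pos one_lt_two)]
  exact Real.binEntropy_le_log_two

theorem IsDensityMatrix.sum_smul {d : Type} [Fintype d] [DecidableEq d] {k : ℕ}
    {p : Fin k → ℝ} {ρ : Fin k → Matrix d d ℂ} (hp : ∀ x, 0 ≤ p x) (hsum : ∑ x, p x = 1)
    (hρ : ∀ x, IsDensityMatrix (ρ x)) : IsDensityMatrix (∑ x, (p x : ℂ) • ρ x) := by
  refine ⟨Matrix.posSemidef_sum _ fun x _ ↦ (hρ x).1.smul (by exact_mod_cast hp x), ?_⟩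
  simp only [Matrix.trace_sum, Matrix.trace_smul, (hρ _).2, smul_eq_mul, mul_one]
  exact_mod_cast hsum

theorem erasureChannel_isHermitian (ε : ℝ) {ρ : Matrix (Fin 2) (Fin 2) ℂ}
    (h : ρ.IsHermitian) : (erasureChannel ε ρ).IsHermitian := by
  ext i j
  have hstar (a b : Fin 2) : (starRingEnd ℂ) (ρ a b) = ρ b a := h.apply b a
  fin_cases i <;> fin_cases j <;> simp [erasureChannel, hstar]

theorem erasureChannel_charpoly (ε : ℝ) {ρ : Matrix (Fin 2) (Fin 2) ℂ}
    (h : ρ.IsHermitian) :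
    (erasureChannel ε ρ).charpoly = ∏ i, (Polynomial.X - Polynomial.C
      ((![(1 - ε) * h.eigenvalues 0, (1 - ε) * h.eigenvalues 1, ε] i : ℝ) : ℂ)) := by
  have ht : Polynomial.C (ρ 0 0 + ρ 1 1) = Polynomial.C
      ((h.eigenvalues 0 : ℂ) + h.eigenvalues 1) := by
    simpa [Matrix.trace_fin_two, Fin.sum_univ_two] using
      congrArg Polynomial.C h.trace_eq_sum_eigenvalues
  have hd : Polynomial.C (ρ 0 0 * ρ 1 1 - ρ 0 1 * ρ 1 0) = Polynomial.C
      ((h.eigenvalues 0 : ℂ) * h.eigenvalues 1) := by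
    simpa [Matrix.det_fin_two, Fin.prod_univ_two] using
      congrArg Polynomial.C h.det_eq_prod_eigenvalues
  simp only [map_add, map_sub, map_mul] at ht hd
  simp only [Matrix.charpoly, Matrix.det_fin_three, Matrix.charmatrix_apply,
    Fin.prod_univ_three]
  simp [erasureChannel]
  linear_combination (Polynomial.X - Polynomial.C (ε : ℂ)) *
    ((1 - Polynomial.C (ε : ℂ)) ^ 2 * hd - (1 - Polynomial.C (ε : ℂ)) * Polynomial.X * ht)

/-- The erasure channel scales the entropy by `1 - ε` and adds the entropy of the erasure flag. -/
theorem vNEntropy_erasureChannel (ε : ℝ) {ρ : Matrix (Fin 2) (Fin 2) ℂ}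
    (h : IsDensityMatrix ρ) :
    vNEntropy (erasureChannel ε ρ) =
      (1 - ε) * vNEntropy ρ + Real.binEntropy ε / Real.log 2 := by
  rw [vNEntropy_eq_of_charpoly_eq (erasureChannel_isHermitian ε h.1.isHermitian) _
    (erasureChannel_charpoly ε h.1.isHermitian), vNEntropy, dif_pos h.1.isHermitian,
    ← mul_div_assoc, ← add_div, Real.binEntropy_eq_negMulLog_add_negMulLog_one_sub]
  congr 1
  simp only [Fin.sum_univ_three, Fin.sum_univ_two, Matrix.cons_val, Real.negMulLog_mul]
  linear_combination Real.negMulLog (1 - ε) * h.eigenvalues_add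

/-- The Holevo quantity of the erasure channel is `1 - ε` times that of the ensemble. -/
theorem erasureChannel_holevo_eq (ε : ℝ) {k : ℕ} {p : Fin k → ℝ}
    {ρ : Fin k → Matrix (Fin 2) (Fin 2) ℂ} (hp : ∀ x, 0 ≤ p x) (hsum : ∑ x, p x = 1)
    (hρ : ∀ x, IsDensityMatrix (ρ x)) :
    vNEntropy (erasureChannel ε (∑ x, (p x : ℂ) • ρ x))
        - ∑ x, p x * vNEntropy (erasureChannel ε (ρ x)) =
      (1 - ε) * (vNEntropy (∑ x, (p x : ℂ) • ρ x) - ∑ x, p x * vNEntropy (ρ x)) := by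
  simp only [vNEntropy_erasureChannel ε (IsDensityMatrix.sum_smul hp hsum hρ),
    vNEntropy_erasureChannel ε (hρ _), mul_add, mul_left_comm _ (1 - ε),
    Finset.sum_add_distrib, ← Finset.mul_sum, ← Finset.sum_mul, hsum]
  ring

theorem isDensityMatrix_diagonal_single {d : Type} [Fintype d] [DecidableEq d] (x : d) :
    IsDensityMatrix (Matrix.diagonal fun i ↦ ((if i = x then 1 else 0 : ℝ) : ℂ)) := by
  refine ⟨Matrix.PosSemidef.diagonal fun i ↦ ?_, ?_⟩
  · dsimp only
    split_ifs <;> simp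
  · rw [Matrix.trace_diagonal, ← Complex.ofReal_sum]
    simp

/-- The Holevo information of the qubit erasure channel `N_ε` equals `1 - ε`:
the value `1 - ε` belongs to the set of achievable Holevo quantities (it is
attained by some ensemble) and it is an upper bound for that set. -/
theorem erasure_holevo_information (ε : ℝ) (hε : ε ∈ Set.Icc (0 : ℝ) 1) :
    IsGreatest (erasureHolevoSet ε) (1 - ε) := by
  constructor
  · have hp : ∀ _ : Fin 2, (0 : ℝ) ≤ 1 / 2 := fun _ ↦ by norm_num
    have hsum : ∑ _ : Fin 2, (1 / 2 : ℝ) = 1 := by norm_num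
    refine ⟨2, fun _ ↦ 1 / 2, _, hp, hsum, isDensityMatrix_diagonal_single, ?_⟩
    rw [erasureChannel_holevo_eq ε hp hsum isDensityMatrix_diagonal_single]
    have hmean : ∑ x : Fin 2, (((1 / 2 : ℝ) : ℝ) : ℂ) • Matrix.diagonal
        (fun i : Fin 2 ↦ ((if i = x then 1 else 0 : ℝ) : ℂ)) =
        Matrix.diagonal fun _ ↦ ((1 / 2 : ℝ) : ℂ) := by
      ext i j
      fin_cases i <;> fin_cases j <;> simp [Fin.sum_univ_two]
    have hlog : Real.log 2 ≠ 0 := (Real.log_pos one_lt_two).ne'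
    rw [hmean]
    simp only [vNEntropy_diagonal]
    simp [apply_ite Real.negMulLog]
    simp [Real.negMulLog]
    field_simp
  · rintro _ ⟨k, p, ρ, hp, hsum, hρ, rfl⟩
    rw [erasureChannel_holevo_eq ε hp hsum hρ]
    refine mul_le_of_le_one_right (sub_nonneg.2 hε.2) ?_
    have hmean := (IsDensityMatrix.sum_smul hp hsum hρ).vNEntropy_le_one
    have hnonneg : 0 ≤ ∑ x, p x * vNEntropy (ρ x) :=
      Finset.sum_nonneg fun x _ ↦ mul_nonneg (hp x) (hρ x).vNEntropy_nonneg
    linarith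
end
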